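/- Let β > n and let X be a random vector in ℝⁿ with (-1/β)-concave density f. Let c₀ ∈ (0,1) satisfy n log c₀ < -β ∑_{i=1}^n (β-i)^{-1}. Then there exists c₁ ∈ (0,1), depending only on c₀, β and n, such that P(f(X) ≥ c₀ⁿ ‖f‖_∞) ≥ 1 - c₁ⁿ. Explicitly, one may take c₁ = c₀^{α*} (∏_{i=1}^n (β-i)/((1-α*)β - i))^{1/n}, where α* ∈ (0, 1 - n/β) is the unique solution of ∑_{i=1}^n β/((1-α*)β - i) = -n log c₀, and this c₁ satisfies c₁ < 1. -/

import Mathlib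

open MeasureTheory ProbabilityTheory Real
open scoped ENNReal

lemma Real.Gamma_eq_prod_sub_mul_Gamma_sub (n : ℕ) {q : ℝ} (hq : (n : ℝ) < q) :
    Gamma q = (∏ i ∈ Finset.Icc 1 n, (q - (i : ℝ))) * Gamma (q - n) := by
  induction n with
  | zero => simp
  | succ k ih =>
    push_cast at hq
    have h := Gamma_add_one (s := q - (k + 1)) (by linarith)
    rw [Finset.prod_Icc_succ_top (by omega), ih (by linarith)]
    push_cast
    rw [mul_assoc, ← h]
    ring_nf

lemma prod_sub_pos {n : ℕ} {q : ℝ} (hq : (n : ℝ) < q) :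
    0 < ∏ i ∈ Finset.Icc 1 n, (q - (i : ℝ)) :=
  Finset.prod_pos fun i hi ↦ by
    have : (i : ℝ) ≤ n := by exact_mod_cast (Finset.mem_Icc.1 hi).2
    linarith

/-- The layer-cake integral of the extremal profile `u ↦ (1/u - 1)ⁿ`. -/
lemma lintegral_rpow_mul_inv_sub_one_pow (n : ℕ) {q : ℝ} (hq : (n : ℝ) < q) :
    ∫⁻ u in Set.Ioo (0 : ℝ) 1,
      ENNReal.ofReal (q * (∏ i ∈ Finset.Icc 1 n, (q - (i : ℝ))) * u ^ (q - 1)) *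
        ENNReal.ofReal ((u⁻¹ - 1) ^ n) = ENNReal.ofReal (n.factorial : ℝ) := by
  have hn : (0 : ℝ) ≤ n := Nat.cast_nonneg n
  have hP := prod_sub_pos hq
  have hfac : (0 : ℝ) < n.factorial := by exact_mod_cast n.factorial_pos
  have hq0 : 0 < q := hn.trans_lt hq
  have hG : 0 < Gamma (q - n) := Gamma_pos_of_pos (by linarith)
  have hbeta : beta (q - n) (n + 1) =
      n.factorial / (q * ∏ i ∈ Finset.Icc 1 n, (q - (i : ℝ))) := by
    rw [beta, Gamma_nat_eq_factorial, show q - n + (n + 1) = q + 1 by ring,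
      Gamma_add_one hq0.ne', Gamma_eq_prod_sub_mul_Gamma_sub n hq]
    field_simp
  have h1 := lintegral_betaPDF_eq_one (α := q - n) (β := n + 1) (by linarith) (by linarith)
  rw [lintegral_betaPDF] at h1
  rw [← mul_one (ENNReal.ofReal (n.factorial : ℝ)), ← h1,
    ← lintegral_const_mul' _ _ ENNReal.ofReal_ne_top]
  refine setLIntegral_congr_fun measurableSet_Ioo fun u ⟨hu0, hu1⟩ ↦ ?_
  rw [← ENNReal.ofReal_mul (by positivity), ← ENNReal.ofReal_mul hfac.le, hbeta]
  congr 1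
  rw [show (n : ℝ) + 1 - 1 = n by ring, rpow_natCast, show u⁻¹ - 1 = (1 - u) / u by field_simp,
    div_pow, show q - n - 1 = (q - 1) - n by ring, rpow_sub hu0 (q - 1) n, rpow_natCast]
  field_simp

lemma ENNReal.mul_add_mul_le_of_le {a b c d : ℝ≥0∞} (hab : a ≤ b) (hcd : c ≤ d) :
    a * d + b * c ≤ a * c + b * d := by
  obtain ⟨e, rfl⟩ := exists_add_of_le hab
  calc a * d + (a + e) * c = a * c + (a * d + e * c) := by ring
    _ ≤ a * c + (a * d + e * d) := by gcongr
    _ = a * c + (a + e) * d := by ring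

section

variable {E : Type*} [NormedAddCommGroup E] [NormedSpace ℝ E] [MeasurableSpace E] [BorelSpace E]
  [FiniteDimensional ℝ E]

/-- If `1/ψ` is convex where `ψ > 0`, the measure of `{v ≤ ψ}` divided by
`(1/v - 1) ^ dim` is nondecreasing, provided that `sup ψ ≥ 1`. -/
lemma addHaar_superlevel_mul_le (μ : Measure E) [μ.IsAddHaarMeasure] {ψ : E → ℝ}
    (hψ : ConvexOn ℝ {x | 0 < ψ x} (fun x ↦ (ψ x)⁻¹)) (hsup : ∀ w < 1, ∃ x, w < ψ x)
    {u v : ℝ} (hu : 0 < u) (huv : u ≤ v) (hv : v < 1) :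
    ENNReal.ofReal ((v⁻¹ - 1) ^ Module.finrank ℝ E) * μ {x | u ≤ ψ x} ≤
      ENNReal.ofReal ((u⁻¹ - 1) ^ Module.finrank ℝ E) * μ {x | v ≤ ψ x} := by
  have hv0 : 0 < v := hu.trans_le huv
  have hi : v⁻¹ ≤ u⁻¹ := inv_anti₀ hu huv
  have hv1 : 1 < v⁻¹ := (one_lt_inv₀ hv0).2 hv
  set d := Module.finrank ℝ E
  have key : ∀ s ∈ Set.Ioo 1 v⁻¹, ENNReal.ofReal (((v⁻¹ - s) / (u⁻¹ - s)) ^ d) *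
      μ {x | u ≤ ψ x} ≤ μ {x | v ≤ ψ x} := by
    rintro s ⟨hs1, hsv⟩
    obtain ⟨x₀, hx₀⟩ := hsup s⁻¹ (inv_lt_one_of_one_lt₀ hs1)
    have hs0 : 0 < s := by linarith
    have hx₀' : 0 < ψ x₀ := (inv_pos.2 hs0).trans hx₀
    have hx₀s : (ψ x₀)⁻¹ ≤ s := (inv_lt_of_inv_lt₀ hs0 hx₀).le
    set l := (v⁻¹ - s) / (u⁻¹ - s)
    have hl0 : 0 ≤ l := div_nonneg (by linarith) (by linarith)
    have hl1 : l ≤ 1 := div_le_one_of_le₀ (by linarith) (by linarith)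
    have hlm : l * (u⁻¹ - s) = v⁻¹ - s := div_mul_cancel₀ _ (by linarith)
    rw [← abs_of_nonneg (pow_nonneg hl0 d), ← Measure.addHaar_image_homothety μ x₀ l]
    refine measure_mono ?_
    rintro _ ⟨x, hx, rfl⟩
    have hx' : 0 < ψ x := hu.trans_le hx
    have hz : AffineMap.homothety x₀ l x = l • x + (1 - l) • x₀ := by
      simp [AffineMap.homothety_apply, smul_sub, sub_smul]; abel
    have hmem : 0 < ψ (l • x + (1 - l) • x₀) :=
      hψ.1 hx' hx₀' hl0 (sub_nonneg.2 hl1) (by ring)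
    have hc := hψ.2 hx' hx₀' hl0 (sub_nonneg.2 hl1) (by ring)
    simp only [smul_eq_mul] at hc
    have h1 : (ψ x)⁻¹ ≤ u⁻¹ := inv_anti₀ hu hx
    have h2 := mul_le_mul_of_nonneg_left h1 hl0
    have h3 := mul_le_mul_of_nonneg_left hx₀s (sub_nonneg.2 hl1)
    rw [Set.mem_ofPred_eq, hz]
    exact (inv_le_inv₀ hmem hv0).1 (by nlinarith)
  have hu1 : 0 < u⁻¹ - 1 := by linarith
  have lim : ENNReal.ofReal (((v⁻¹ - 1) / (u⁻¹ - 1)) ^ d) * μ {x | u ≤ ψ x} ≤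
      μ {x | v ≤ ψ x} := by
    have hcont : Filter.Tendsto (fun s : ℝ ↦ ((v⁻¹ - s) / (u⁻¹ - s)) ^ d)
        (nhdsWithin 1 (Set.Ioi 1)) (nhds (((v⁻¹ - 1) / (u⁻¹ - 1)) ^ d)) := by
      apply tendsto_nhdsWithin_of_tendsto_nhds
      exact ContinuousAt.tendsto (f := fun s : ℝ ↦ ((v⁻¹ - s) / (u⁻¹ - s)) ^ d)
        (by fun_prop (disch := exact hu1.ne'))
    have hpos : ENNReal.ofReal (((v⁻¹ - 1) / (u⁻¹ - 1)) ^ d) ≠ 0 := by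
      have : 0 < v⁻¹ - 1 := by linarith
      simp only [ne_eq, ENNReal.ofReal_eq_zero, not_le]
      positivity
    refine le_of_tendsto (ENNReal.Tendsto.mul_const (ENNReal.tendsto_ofReal hcont)
      (Or.inl hpos)) ?_
    filter_upwards [Ioo_mem_nhdsGT hv1] with s hs using key s hs
  calc _ = ENNReal.ofReal ((u⁻¹ - 1) ^ d) *
        (ENNReal.ofReal (((v⁻¹ - 1) / (u⁻¹ - 1)) ^ d) * μ {x | u ≤ ψ x}) := by
        rw [← mul_assoc, ← ENNReal.ofReal_mul (by positivity), ← mul_pow,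
          mul_div_cancel₀ _ hu1.ne']
    _ ≤ _ := by gcongr

lemma lintegral_rpow_eq_setLIntegral_Ioo {α : Type*} [MeasurableSpace α] (μ : Measure α)
    {ψ : α → ℝ} (h0 : 0 ≤ᵐ[μ] ψ) (hm : AEMeasurable ψ μ) (h1 : ∀ᵐ x ∂μ, ψ x ≤ 1)
    {c q : ℝ} (hc : 0 ≤ c) (hq : 0 < q) :
    ENNReal.ofReal c * ∫⁻ x, ENNReal.ofReal (ψ x ^ q) ∂μ =
      ∫⁻ u in Set.Ioo (0 : ℝ) 1, ENNReal.ofReal (q * c * u ^ (q - 1)) * μ {x | u ≤ ψ x} := by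
  have hsub : ∫⁻ t in Set.Ioi (0 : ℝ), μ {x | t ≤ ψ x} * ENNReal.ofReal (t ^ (q - 1)) =
      ∫⁻ t in Set.Ioo (0 : ℝ) 1, μ {x | t ≤ ψ x} * ENNReal.ofReal (t ^ (q - 1)) := by
    rw [← Set.Ioc_union_Ioi_eq_Ioi zero_le_one,
      lintegral_union measurableSet_Ioi (Set.Ioc_disjoint_Ioi le_rfl),
      setLIntegral_congr Ioo_ae_eq_Ioc.symm]
    refine (congrArg _ (setLIntegral_eq_zero measurableSet_Ioi fun t ht ↦ ?_)).trans (add_zero _)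
    have : μ {x | t ≤ ψ x} = 0 := by
      refine measure_mono_null (fun x hx ↦ ?_) h1
      simpa using lt_of_lt_of_le ht hx
    simp [this]
  rw [lintegral_rpow_eq_lintegral_meas_le_mul μ h0 hm hq, hsub, ← mul_assoc,
    ← ENNReal.ofReal_mul hc, ← lintegral_const_mul' _ _ ENNReal.ofReal_ne_top]
  refine setLIntegral_congr_fun measurableSet_Ioo fun u hu ↦ ?_
  rw [mul_comm (μ _), ← mul_assoc, ← ENNReal.ofReal_mul (by positivity), mul_comm c q]

/-- A reverse Hölder (Berwald type) inequality: if `1/ψ` is convex where `ψ > 0` and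
`ess sup ψ = 1`, then `q ↦ ∏ (q - i) ∫ ψ ^ q` is nondecreasing. -/
lemma prod_mul_lintegral_rpow_le (μ : Measure E) [μ.IsAddHaarMeasure] {ψ : E → ℝ}
    (h0 : ∀ x, 0 ≤ ψ x) (hm : AEMeasurable ψ μ) (h1 : ∀ᵐ x ∂μ, ψ x ≤ 1)
    (hψ : ConvexOn ℝ {x | 0 < ψ x} (fun x ↦ (ψ x)⁻¹)) (hsup : ∀ w < 1, ∃ x, w < ψ x)
    {n : ℕ} (hn : Module.finrank ℝ E = n) {q b : ℝ} (hq : (n : ℝ) < q) (hqb : q < b) :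
    ENNReal.ofReal (∏ i ∈ Finset.Icc 1 n, (q - (i : ℝ))) * ∫⁻ x, ENNReal.ofReal (ψ x ^ q) ∂μ ≤
      ENNReal.ofReal (∏ i ∈ Finset.Icc 1 n, (b - (i : ℝ))) *
        ∫⁻ x, ENNReal.ofReal (ψ x ^ b) ∂μ := by
  have hnb : (n : ℝ) < b := hq.trans hqb
  have hq0 : 0 < q := (Nat.cast_nonneg n).trans_lt hq
  have hb0 : 0 < b := hq0.trans hqb
  have hPq := prod_sub_pos hq
  have hPb := prod_sub_pos hnb
  by_cases hfin : ∫⁻ x, ENNReal.ofReal (ψ x ^ b) ∂μ = ∞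
  · rw [hfin, ENNReal.mul_top (by simpa using hPb)]
    exact le_top
  set W : ℝ → ℝ≥0∞ := fun u ↦ μ {x | u ≤ ψ x}
  have hWm : Measurable W :=
    Antitone.measurable fun s t hst ↦ measure_mono fun x hx ↦ hst.trans hx
  have hWfin : ∀ u, 0 < u → W u ≠ ∞ := by
    intro u hu htop
    have h := mul_meas_ge_le_lintegral₀ (hm.pow_const b).ennreal_ofReal
      (ENNReal.ofReal (u ^ b)) (μ := μ)
    have hle : W u ≤ μ {x | ENNReal.ofReal (u ^ b) ≤ ENNReal.ofReal (ψ x ^ b)} :=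
      measure_mono fun x hx ↦ ENNReal.ofReal_le_ofReal (rpow_le_rpow hu.le hx hb0.le)
    rw [htop, top_le_iff] at hle
    rw [hle, ENNReal.mul_top (by simpa using rpow_pos_of_pos hu b), top_le_iff] at h
    exact hfin h
  rw [lintegral_rpow_eq_setLIntegral_Ioo μ (ae_of_all _ h0) hm h1 hPq.le hq0,
    lintegral_rpow_eq_setLIntegral_Ioo μ (ae_of_all _ h0) hm h1 hPb.le hb0]
  set Aq : ℝ → ℝ≥0∞ := fun u ↦
    ENNReal.ofReal (q * (∏ i ∈ Finset.Icc 1 n, (q - (i : ℝ))) * u ^ (q - 1))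
  set Ab : ℝ → ℝ≥0∞ := fun u ↦
    ENNReal.ofReal (b * (∏ i ∈ Finset.Icc 1 n, (b - (i : ℝ))) * u ^ (b - 1))
  set r : ℝ → ℝ≥0∞ := fun u ↦ ENNReal.ofReal ((u⁻¹ - 1) ^ n) with hr
  have hAqm : Measurable Aq := by fun_prop
  have hAbm : Measurable Ab := by fun_prop
  have hrm : Measurable r := by fun_prop
  set cq := q * ∏ i ∈ Finset.Icc 1 n, (q - (i : ℝ))
  set cb := b * ∏ i ∈ Finset.Icc 1 n, (b - (i : ℝ))
  have hcq0 : 0 < cq := by positivity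
  have hcb0 : 0 < cb := by positivity
  have hcc : cq < cb := by
    refine mul_lt_mul hqb (Finset.prod_le_prod (fun i hi ↦ ?_) fun i _ ↦ by linarith) hPq hb0.le
    have : (i : ℝ) ≤ n := by exact_mod_cast (Finset.mem_Icc.1 hi).2
    linarith
  -- the point where `Aq` and `Ab` cross
  set u₀ := (cq / cb) ^ (b - q)⁻¹
  have hu₀0 : 0 < u₀ := by positivity
  have hu₀1 : u₀ < 1 :=
    rpow_lt_one (by positivity) ((div_lt_one hcb0).2 hcc) (inv_pos.2 (by linarith))
  have hu₀p : u₀ ^ (b - q) = cq / cb := rpow_inv_rpow (by positivity) (by linarith)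
  have hfac : ∀ u : ℝ, 0 < u → cb * u ^ (b - 1) = cb * u ^ (b - q) * u ^ (q - 1) := by
    intro u hu
    rw [mul_assoc cb, ← rpow_add hu]
    ring_nf
  have hr0 : r u₀ ≠ 0 := by
    have : 0 < u₀⁻¹ - 1 := sub_pos.2 ((one_lt_inv₀ hu₀0).2 hu₀1)
    simp only [hr, ne_eq, ENNReal.ofReal_eq_zero, not_le]
    positivity
  have hrt : r u₀ ≠ ∞ := ENNReal.ofReal_ne_top
  set G := W u₀ / r u₀ with hG
  have hGt : G ≠ ∞ := ENNReal.div_ne_top (hWfin u₀ hu₀0) hr0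
  have hpt : ∀ u ∈ Set.Ioo (0 : ℝ) 1,
      Aq u * W u + Ab u * (r u * G) ≤ Aq u * (r u * G) + Ab u * W u := by
    rintro u ⟨hu0, hu1⟩
    rcases le_total u u₀ with h | h
    · have hA : Ab u ≤ Aq u := by
        refine ENNReal.ofReal_le_ofReal ?_
        rw [hfac u hu0]
        have h2 : u ^ (b - q) ≤ cq / cb := hu₀p ▸ rpow_le_rpow hu0.le h (by linarith)
        rw [le_div_iff₀' hcb0] at h2
        gcongr
      have hWr : W u ≤ r u * G := by
        have h2 := addHaar_superlevel_mul_le μ hψ hsup hu0 h hu₀1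
        rw [hn] at h2
        rw [hG, ← mul_div_assoc, ENNReal.le_div_iff_mul_le (Or.inl hr0) (Or.inl hrt), mul_comm]
        exact h2
      rw [add_comm, add_comm (Aq u * _)]
      exact ENNReal.mul_add_mul_le_of_le hA hWr
    · have hA : Aq u ≤ Ab u := by
        refine ENNReal.ofReal_le_ofReal ?_
        rw [hfac u hu0]
        have h2 : cq / cb ≤ u ^ (b - q) := hu₀p ▸ rpow_le_rpow hu₀0.le h (by linarith)
        rw [div_le_iff₀' hcb0] at h2
        gcongr
      have hWr : r u * G ≤ W u := by
        have h2 := addHaar_superlevel_mul_le μ hψ hsup hu₀0 h hu1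
        rw [hn] at h2
        rw [hG, ← mul_div_assoc]
        exact ENNReal.div_le_of_le_mul (by rwa [mul_comm (W u)])
      exact ENNReal.mul_add_mul_le_of_le hA hWr
  have hint := setLIntegral_mono (μ := volume) (by fun_prop) hpt
  rw [lintegral_add_left (by fun_prop), lintegral_add_left (by fun_prop)] at hint
  have hK : ∀ A : ℝ → ℝ≥0∞, Measurable A → ∫⁻ u in Set.Ioo (0 : ℝ) 1, A u * (r u * G) =
      (∫⁻ u in Set.Ioo (0 : ℝ) 1, A u * r u) * G := by
    intro A hA
    rw [← lintegral_mul_const' _ _ hGt]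
    simp_rw [mul_assoc]
  rw [hK Ab hAbm, hK Aq hAqm, lintegral_rpow_mul_inv_sub_one_pow n hq,
    lintegral_rpow_mul_inv_sub_one_pow n hnb, add_comm] at hint
  exact (ENNReal.add_le_add_iff_left (ENNReal.mul_ne_top ENNReal.ofReal_ne_top hGt)).1 hint

lemma convex_superlevel_of_convexOn_rpow_neg {V : Type*} [AddCommGroup V] [Module ℝ V]
    {f : V → ℝ} {β : ℝ} (hβ : 0 < β)
    (hf : ConvexOn ℝ {x | 0 < f x} (fun x ↦ f x ^ (-1 / β))) {t : ℝ} (ht : 0 < t) :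
    Convex ℝ {x | t ≤ f x} := by
  convert hf.convex_le (t ^ (-1 / β)) using 1
  ext x
  have he : -1 / β < 0 := div_neg_of_neg_of_pos (by norm_num) hβ
  refine ⟨fun h ↦ ⟨ht.trans_le h, rpow_le_rpow_of_nonpos ht h he.le⟩, fun ⟨h0, h⟩ ↦ ?_⟩
  exact (rpow_le_rpow_iff_of_neg h0 ht he).1 h

lemma aemeasurable_of_convexOn_rpow_neg (μ : Measure E) [μ.IsAddHaarMeasure]
    {f : E → ℝ} (h0 : ∀ x, 0 ≤ f x) {β : ℝ} (hβ : 0 < β)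
    (hf : ConvexOn ℝ {x | 0 < f x} (fun x ↦ f x ^ (-1 / β))) : AEMeasurable f μ := by
  refine NullMeasurable.aemeasurable (measurable_of_Ici fun t ↦ ?_)
  change NullMeasurableSet {x | t ≤ f x} μ
  rcases le_or_gt t 0 with ht | ht
  · have : {x | t ≤ f x} = Set.univ := Set.eq_univ_of_forall fun x ↦ ht.trans (h0 x)
    rw [this]
    exact nullMeasurableSet_univ
  · exact (convex_superlevel_of_convexOn_rpow_neg hβ hf ht).nullMeasurableSet μ

/-- Left tail bound for a `(-1/β)`-concave density. -/
lemma setLIntegral_lt_le_of_convexOn_rpow_neg (μ : Measure E) [μ.IsAddHaarMeasure]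
    {n : ℕ} (hn : Module.finrank ℝ E = n) {f : E → ℝ} (h0 : ∀ x, 0 ≤ f x) {β : ℝ}
    (hβ : (n : ℝ) < β) (hf : ConvexOn ℝ {x | 0 < f x} (fun x ↦ f x ^ (-1 / β)))
    {M : ℝ} (hM : 0 < M) (hle : ∀ᵐ x ∂μ, f x ≤ M) (hsup : ∀ w < M, ∃ x, w < f x)
    {α : ℝ} (hα : α ∈ Set.Ioo (0 : ℝ) (1 - n / β)) {c : ℝ} (hc : 0 < c) :
    ∫⁻ x in {x | f x < c * M}, ENNReal.ofReal (f x) ∂μ ≤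
      ENNReal.ofReal (c ^ α * ∏ i ∈ Finset.Icc 1 n, (β - (i : ℝ)) / ((1 - α) * β - (i : ℝ))) *
        ∫⁻ x, ENNReal.ofReal (f x) ∂μ := by
  have hβ0 : 0 < β := (Nat.cast_nonneg n).trans_lt hβ
  have hq : (n : ℝ) < (1 - α) * β := by
    have := hα.2
    rw [← div_lt_iff₀ hβ0]
    linarith
  have hqβ : (1 - α) * β < β := by nlinarith [hα.1]
  have hfm := aemeasurable_of_convexOn_rpow_neg μ h0 hβ0 hf
  set ψ : E → ℝ := fun x ↦ (f x / M) ^ β⁻¹ with hψ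
  have hg0 : ∀ x, 0 ≤ f x / M := fun x ↦ div_nonneg (h0 x) hM.le
  have hψpos : ∀ x, 0 < ψ x ↔ 0 < f x := by
    refine fun x ↦ ⟨fun h ↦ (h0 x).lt_of_ne fun h' ↦ ?_,
      fun h ↦ rpow_pos_of_pos (div_pos h hM) _⟩
    simp [hψ, ← h', zero_rpow (inv_pos.2 hβ0).ne'] at h
  have hψc : ConvexOn ℝ {x | 0 < ψ x} (fun x ↦ (ψ x)⁻¹) := by
    simp only [hψpos]
    refine (hf.smul (rpow_nonneg hM.le β⁻¹)).congr fun x hx ↦ ?_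
    simp only [smul_eq_mul, hψ]
    rw [div_rpow (h0 x) hM.le, inv_div, neg_div, one_div, rpow_neg (h0 x), div_eq_mul_inv]
  have hψsup : ∀ w < 1, ∃ x, w < ψ x := by
    intro w hw
    obtain ⟨x, hx⟩ := hsup ((max w 0) ^ β * M) (by
      have : (max w 0) ^ β < 1 := rpow_lt_one (le_max_right _ _) (max_lt hw one_pos) hβ0
      nlinarith)
    refine ⟨x, (le_max_left w 0).trans_lt ?_⟩
    rw [← lt_div_iff₀ hM] at hx
    exact (lt_rpow_inv_iff_of_pos (le_max_right _ _) (hg0 x) hβ0).2 hx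
  have hψ1 : ∀ᵐ x ∂μ, ψ x ≤ 1 := by
    filter_upwards [hle] with x hx
    exact rpow_le_one (hg0 x) ((div_le_one hM).2 hx) (inv_pos.2 hβ0).le
  have hψm : AEMeasurable ψ μ := (hfm.div_const M).pow_const _
  have main := prod_mul_lintegral_rpow_le μ (fun x ↦ rpow_nonneg (hg0 x) _) hψm hψ1 hψc hψsup
    hn hq hqβ
  have hψβ : ∀ x, ψ x ^ β = f x / M := fun x ↦ rpow_inv_rpow (hg0 x) hβ0.ne'
  have hPq := prod_sub_pos hq
  have hPβ := prod_sub_pos hβ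
  set Pq := ∏ i ∈ Finset.Icc 1 n, ((1 - α) * β - (i : ℝ))
  set Pβ := ∏ i ∈ Finset.Icc 1 n, (β - (i : ℝ))
  have hpt : ∀ x, f x < c * M → f x ≤ M * c ^ α * ψ x ^ ((1 - α) * β) := by
    intro x hx
    have hψx : 0 ≤ ψ x := rpow_nonneg (hg0 x) _
    rcases (h0 x).eq_or_lt with h | h
    · rw [← h]
      positivity
    have hg : 0 < f x / M := div_pos h hM
    rw [mul_comm (1 - α), rpow_mul hψx, hψβ]
    calc f x = M * ((f x / M) ^ α * (f x / M) ^ (1 - α)) := by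
          rw [← rpow_add hg]
          simp [mul_div_cancel₀ _ hM.ne']
      _ ≤ M * (c ^ α * (f x / M) ^ (1 - α)) := by
          gcongr
          · exact hα.1.le
          · exact ((div_lt_iff₀ hM).2 hx).le
      _ = _ := by ring
  have hS : NullMeasurableSet {x | f x < c * M} μ := nullMeasurableSet_lt hfm aemeasurable_const
  have hprod : ∏ i ∈ Finset.Icc 1 n, (β - (i : ℝ)) / ((1 - α) * β - (i : ℝ)) = Pβ / Pq :=
    Finset.prod_div_distrib ..
  rw [hprod]
  calc ∫⁻ x in {x | f x < c * M}, ENNReal.ofReal (f x) ∂μ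
      ≤ ∫⁻ x in {x | f x < c * M}, ENNReal.ofReal (M * c ^ α) *
          ENNReal.ofReal (ψ x ^ ((1 - α) * β)) ∂μ := by
        refine lintegral_mono_ae ((ae_restrict_iff'₀ hS).2 (ae_of_all _ fun x hx ↦ ?_))
        rw [← ENNReal.ofReal_mul (by positivity)]
        exact ENNReal.ofReal_le_ofReal (hpt x hx)
    _ ≤ ∫⁻ x, ENNReal.ofReal (M * c ^ α) * ENNReal.ofReal (ψ x ^ ((1 - α) * β)) ∂μ :=
        setLIntegral_le_lintegral _ _
    _ = ENNReal.ofReal (M * c ^ α / Pq) *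
          (ENNReal.ofReal Pq * ∫⁻ x, ENNReal.ofReal (ψ x ^ ((1 - α) * β)) ∂μ) := by
        rw [lintegral_const_mul' _ _ ENNReal.ofReal_ne_top, ← mul_assoc,
          ← ENNReal.ofReal_mul (by positivity), div_mul_cancel₀ _ hPq.ne']
    _ ≤ ENNReal.ofReal (M * c ^ α / Pq) *
          (ENNReal.ofReal Pβ * ∫⁻ x, ENNReal.ofReal (ψ x ^ β) ∂μ) := by gcongr
    _ = ENNReal.ofReal (M * c ^ α / Pq) *
          (ENNReal.ofReal Pβ * (ENNReal.ofReal M⁻¹ * ∫⁻ x, ENNReal.ofReal (f x) ∂μ)) := by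
        rw [← lintegral_const_mul' (ENNReal.ofReal M⁻¹) _ ENNReal.ofReal_ne_top]
        refine congrArg _ (congrArg _ (lintegral_congr fun x ↦ ?_))
        rw [hψβ, ← ENNReal.ofReal_mul (inv_pos.2 hM).le, div_eq_inv_mul]
    _ = _ := by
        rw [← mul_assoc, ← mul_assoc, ← ENNReal.ofReal_mul (by positivity),
          ← ENNReal.ofReal_mul (by positivity)]
        congr 2
        field_simp

end

lemma log_prod_div_lt_sum {n : ℕ} (hn : 0 < n) {a b : ℝ} (ha : (n : ℝ) < a) (hab : a < b) :
    log (∏ i ∈ Finset.Icc 1 n, (b - (i : ℝ)) / (a - (i : ℝ))) <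
      ∑ i ∈ Finset.Icc 1 n, (b - a) / (a - (i : ℝ)) := by
  have hpos : ∀ i ∈ Finset.Icc 1 n, 0 < a - (i : ℝ) := fun i hi ↦ by
    have : (i : ℝ) ≤ n := by exact_mod_cast (Finset.mem_Icc.1 hi).2
    linarith
  rw [log_prod fun i hi ↦ (div_pos (by linarith [hpos i hi]) (hpos i hi)).ne']
  refine Finset.sum_lt_sum_of_nonempty (Finset.nonempty_Icc.2 hn) fun i hi ↦ ?_
  have h := hpos i hi
  calc _ < (b - i) / (a - i) - 1 :=
        log_lt_sub_one_of_pos (div_pos (by linarith) h) ((one_lt_div h).2 (by linarith)).ne'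
    _ = _ := by field_simp; ring

/-- Let `β > n` and let `X` have a `(-1/β)`-concave density `f` on `ℝⁿ`.
If `c₀ ∈ (0,1)` satisfies `n log c₀ < -β ∑_{i=1}^n (β-i)⁻¹`, and `α* ∈ (0, 1 - n/β)` solves
`∑_{i=1}^n β/((1-α*)β - i) = -n log c₀`, then
`c₁ = c₀^{α*} (∏_{i=1}^n (β-i)/((1-α*)β - i))^{1/n}` satisfies `0 < c₁ < 1` and
`P(f(X) ≥ c₀ⁿ ‖f‖_∞) ≥ 1 - c₁ⁿ`. -/
theorem stmt18
    {Ω : Type*} [MeasureSpace Ω] [IsProbabilityMeasure (ℙ : Measure Ω)]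
    (n : ℕ) (hn : 0 < n) (β : ℝ) (hβ : (n : ℝ) < β)
    (X : Ω → (Fin n → ℝ)) (hX : Measurable X)
    (f : (Fin n → ℝ) → ℝ) (hf_nonneg : ∀ x, 0 ≤ f x)
    (hf_density : Measure.map X ℙ = volume.withDensity (fun x => ENNReal.ofReal (f x)))
    (hf_conv : ConvexOn ℝ {x | 0 < f x} (fun x => f x ^ (-1 / β)))
    (c₀ : ℝ) (hc₀ : c₀ ∈ Set.Ioo (0 : ℝ) 1)
    (hc₀' : (n : ℝ) * Real.log c₀ < -β * ∑ i ∈ Finset.Icc 1 n, (β - (i : ℝ))⁻¹)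
    (αst : ℝ) (hαst : αst ∈ Set.Ioo (0 : ℝ) (1 - n / β))
    (hαeq : ∑ i ∈ Finset.Icc 1 n, β / ((1 - αst) * β - (i : ℝ))
      = -(n : ℝ) * Real.log c₀) :
    0 < c₀ ^ αst * (∏ i ∈ Finset.Icc 1 n, (β - (i : ℝ)) / ((1 - αst) * β - (i : ℝ)))
          ^ (1 / (n : ℝ)) ∧
    c₀ ^ αst * (∏ i ∈ Finset.Icc 1 n, (β - (i : ℝ)) / ((1 - αst) * β - (i : ℝ)))
          ^ (1 / (n : ℝ)) < 1 ∧
    1 - (c₀ ^ αst * (∏ i ∈ Finset.Icc 1 n, (β - (i : ℝ)) / ((1 - αst) * β - (i : ℝ)))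
          ^ (1 / (n : ℝ))) ^ (n : ℕ)
      ≤ (ℙ {ω | c₀ ^ (n : ℕ) * essSup f volume ≤ f (X ω)}).toReal := by
  have hn0 : (0 : ℝ) < n := by exact_mod_cast hn
  have hβ0 : 0 < β := hn0.trans hβ
  have hq : (n : ℝ) < (1 - αst) * β := by
    have := hαst.2
    rw [← div_lt_iff₀ hβ0]
    linarith
  have hqβ : (1 - αst) * β < β := by nlinarith [hαst.1]
  have hlog := log_prod_div_lt_sum hn hq hqβ
  have hP : 0 < ∏ i ∈ Finset.Icc 1 n, (β - (i : ℝ)) / ((1 - αst) * β - (i : ℝ)) := by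
    rw [Finset.prod_div_distrib]
    exact div_pos (prod_sub_pos hβ) (prod_sub_pos hq)
  have hbound := fun M hM hle hsup ↦ setLIntegral_lt_le_of_convexOn_rpow_neg
    (volume : Measure (Fin n → ℝ)) (n := n) (by simp) hf_nonneg hβ hf_conv (M := M) hM hle hsup
    hαst (pow_pos hc₀.1 n)
  set P := ∏ i ∈ Finset.Icc 1 n, (β - (i : ℝ)) / ((1 - αst) * β - (i : ℝ))
  have hc₀α : 0 < c₀ ^ αst := rpow_pos_of_pos hc₀.1 _
  have hc₁ : 0 < c₀ ^ αst * P ^ (1 / (n : ℝ)) := mul_pos hc₀α (rpow_pos_of_pos hP _)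
  have hpow : (c₀ ^ αst * P ^ (1 / (n : ℝ))) ^ n = (c₀ ^ n) ^ αst * P := by
    rw [mul_pow, one_div, rpow_inv_natCast_pow hP.le hn.ne', ← rpow_natCast, ← rpow_mul hc₀.1.le,
      ← rpow_natCast c₀, ← rpow_mul hc₀.1.le, mul_comm αst]
  refine ⟨hc₁, ?_, ?_⟩
  · have hsum : ∑ i ∈ Finset.Icc 1 n, (β - (1 - αst) * β) / ((1 - αst) * β - (i : ℝ)) =
        αst * (-(n : ℝ) * log c₀) := by
      rw [← hαeq, Finset.mul_sum]
      exact Finset.sum_congr rfl fun i _ ↦ by ring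
    rw [← pow_lt_one_iff_of_nonneg hc₁.le hn.ne', hpow,
      ← log_neg_iff (mul_pos (rpow_pos_of_pos (pow_pos hc₀.1 n) _) hP),
      log_mul (rpow_pos_of_pos (pow_pos hc₀.1 n) _).ne' hP.ne', log_rpow (pow_pos hc₀.1 n), log_pow]
    linarith
  rw [hpow]
  have hdens : ∫⁻ x, ENNReal.ofReal (f x) = 1 := by
    have := congrArg (fun μ : Measure (Fin n → ℝ) ↦ μ Set.univ) hf_density
    simpa [Measure.map_apply hX MeasurableSet.univ] using this.symm
  rcases le_or_gt (essSup f volume) 0 with hM | hM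
  · have huniv : {ω | c₀ ^ n * essSup f volume ≤ f (X ω)} = Set.univ :=
      Set.eq_univ_of_forall fun ω ↦
        (mul_nonpos_of_nonneg_of_nonpos (pow_pos hc₀.1 n).le hM).trans (hf_nonneg _)
    have : 0 < (c₀ ^ n) ^ αst * P := mul_pos (rpow_pos_of_pos (pow_pos hc₀.1 n) _) hP
    simp only [huniv, measure_univ, ENNReal.toReal_one]
    linarith
  have hbdd : Filter.IsBoundedUnder (· ≤ ·) (ae (volume : Measure (Fin n → ℝ))) f := by
    by_contra h
    have hempty : {a : ℝ | ∀ᵐ x, f x ≤ a} = ∅ :=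
      Set.eq_empty_of_forall_notMem fun a ha ↦ h ⟨a, Filter.eventually_map.2 ha⟩
    have : essSup f volume = 0 := by
      rw [essSup, Filter.limsup_eq, hempty, Real.sInf_empty]
    exact hM.ne' this
  have hcobdd : Filter.IsCoboundedUnder (· ≤ ·) (ae (volume : Measure (Fin n → ℝ))) f :=
    Filter.isCoboundedUnder_le_of_le _ hf_nonneg
  have hsup : ∀ w < essSup f volume, ∃ x, w < f x := by
    intro w hw
    by_contra! h
    exact hw.not_ge (essSup_le_of_ae_le w (ae_of_all _ h) hcobdd)
  have htail := hbound _ hM (ae_le_essSup hbdd) hsup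
  rw [hdens, mul_one] at htail
  have hfm := aemeasurable_of_convexOn_rpow_neg (volume : Measure (Fin n → ℝ)) hf_nonneg hβ0 hf_conv
  set S := {x | f x < c₀ ^ n * essSup f volume}
  have hS : NullMeasurableSet S volume := nullMeasurableSet_lt hfm aemeasurable_const
  have hSX : NullMeasurableSet S (Measure.map X ℙ) :=
    hS.mono_ac (hf_density ▸ withDensity_absolutelyContinuous _ _)
  have hcompl : {ω | c₀ ^ n * essSup f volume ≤ f (X ω)} = (X ⁻¹' S)ᶜ := by
    ext ω
    simp [S]
  have hXS : ℙ (X ⁻¹' S) ≤ ENNReal.ofReal ((c₀ ^ n) ^ αst * P) := by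
    rw [← Measure.map_apply₀ hX.aemeasurable hSX, hf_density, withDensity_apply₀ _ hS]
    exact htail
  rw [hcompl, prob_compl_eq_one_sub₀ (hSX.preimage (hX.quasiMeasurePreserving ℙ)),
    ENNReal.toReal_sub_of_le prob_le_one ENNReal.one_ne_top, ENNReal.toReal_one]
  have := ENNReal.toReal_le_of_le_ofReal
    (mul_pos (rpow_pos_of_pos (pow_pos hc₀.1 n) _) hP).le hXS
  linarith
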